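/- arXiv:1910.05193 — 5 statements merged into one kernel-verified Lean document; each statement's English description precedes it below -/
import Mathlib

section
/- Let G = (V,E) be a finite simple connected bipartite graph with |V| ≥ 2 and fix a vertex v0 ∈ V. Then the number of facet-defining labelings of G based at v0 is at most 2^(|V|−1). -/
open SimpleGraph

/-- The subgraph of `G` whose edges are those edges `{u, v}` of `G` with
`|f u - f v| = 1`. -/
def labelSubgraph {V : Type*} (G : SimpleGraph V) (f : V → ℤ) : SimpleGraph V where
  Adj u v := G.Adj u v ∧ |f u - f v| = 1
  symm := ⟨fun u v h => ⟨h.1.symm, by rw [abs_sub_comm]; exact h.2⟩⟩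
  loopless := ⟨fun u h => G.loopless.irrefl u h.1⟩

/-- A facet-defining labeling of `G` based at `v0`: a function `f : V → ℤ` with
`f v0 = 0`, `|f u - f v| ≤ 1` on every edge, and such that the edges with
`|f u - f v| = 1` form a connected spanning subgraph of `G`. -/
def IsFacetLabeling {V : Type*} (G : SimpleGraph V) (v0 : V) (f : V → ℤ) : Prop :=
  f v0 = 0 ∧ (∀ u v, G.Adj u v → |f u - f v| ≤ 1) ∧ (labelSubgraph G f).Connected

/-- In a properly 2-colored graph, two vertices joined by a path in the label subgraph have labels
of the same parity exactly when they have the same color. -/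
lemma even_iff_even_iff_color_eq {V : Type*} {G : SimpleGraph V} (C : G.Coloring (Fin 2))
    {f : V → ℤ} {u v : V} (h : (labelSubgraph G f).Reachable u v) :
    (Even (f u) ↔ Even (f v)) ↔ C u = C v := by
  obtain ⟨p⟩ := h
  induction p with
  | nil => simp
  | @cons u v w hadj p ih =>
    have hC := C.valid hadj.1
    have hf : Even (f u) ↔ ¬ Even (f v) := by
      have h1 := hadj.2
      rw [Int.even_iff, Int.even_iff]
      rcases (abs_eq (by norm_num)).1 h1 with h | h <;> omega
    have hC' : C u = C w ↔ ¬ C v = C w := by omega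
    tauto

/-- A facet-defining labeling of a bipartite graph changes along every edge. -/
lemma IsFacetLabeling.abs_sub_eq_one {V : Type*} {G : SimpleGraph V} {v0 : V} {f : V → ℤ}
    (hf : IsFacetLabeling G v0 f) (hbip : G.Colorable 2) {u v : V} (h : G.Adj u v) :
    |f u - f v| = 1 := by
  obtain ⟨C⟩ := hbip
  have hle := hf.2.1 u v h
  have hne : f u ≠ f v := fun he =>
    C.valid h ((even_iff_even_iff_color_eq C (hf.2.2.preconnected u v)).1 (by rw [he]))
  have hpos : 0 < |f u - f v| := abs_pos.2 (sub_ne_zero.2 hne)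
  omega

/-- In a connected graph, every vertex other than the root has a neighbor closer to the root. -/
lemma SimpleGraph.Connected.exists_adj_dist_lt {V : Type*} {G : SimpleGraph V}
    (hconn : G.Connected) {v v0 : V} (hv : v ≠ v0) :
    ∃ u, G.Adj v u ∧ G.dist u v0 < G.dist v v0 := by
  obtain ⟨p, hp⟩ := hconn.exists_walk_length_eq_dist v v0
  cases p with
  | nil => exact absurd rfl hv
  | @cons _ u _ h q =>
    refine ⟨u, h, ?_⟩
    have := SimpleGraph.dist_le q
    rw [SimpleGraph.Walk.length_cons] at hp
    omega

/-- For a finite simple connected bipartite graph `G` with at least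
two vertices, the number of facet-defining labelings based at a fixed vertex `v0`
is at most `2 ^ (|V| - 1)`. -/
theorem stmt2 {V : Type*} [Fintype V] (G : SimpleGraph V)
    (hconn : G.Connected) (hbip : G.Colorable 2)
    (hcard : 2 ≤ Fintype.card V) (v0 : V) :
    Nat.card {f : V → ℤ // IsFacetLabeling G v0 f} ≤ 2 ^ (Fintype.card V - 1) := by
  classical
  choose p hadj hlt using fun v : {v : V // v ≠ v0} => hconn.exists_adj_dist_lt v.2
  have hinj : Function.Injective
      (fun (f : {f : V → ℤ // IsFacetLabeling G v0 f}) (v : {v : V // v ≠ v0}) =>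
        decide (f.1 v - f.1 (p v) = 1)) := by
    intro f g hfg
    have key : ∀ n v, G.dist v v0 = n → f.1 v = g.1 v := by
      intro n
      induction n using Nat.strong_induction_on with
      | _ n ih =>
        intro v hv
        by_cases hv0 : v = v0
        · rw [hv0, f.2.1, g.2.1]
        · have hp := ih _ (hv ▸ hlt ⟨v, hv0⟩) _ rfl
          have hd := decide_eq_decide.1 (congrFun hfg ⟨v, hv0⟩)
          have hf := f.2.abs_sub_eq_one hbip (hadj ⟨v, hv0⟩)
          have hg := g.2.abs_sub_eq_one hbip (hadj ⟨v, hv0⟩)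
          rw [abs_eq (by norm_num)] at hf hg
          dsimp only at hd hf hg
          omega
    exact Subtype.ext (funext fun v => key _ v rfl)
  refine (Nat.card_le_card_of_injective _ hinj).trans_eq ?_
  simp [Nat.card_eq_fintype_card, Fintype.card_subtype_compl]
end

section
/- Let k ≥ 2 and let C_{2k} be the cycle graph on vertex set ℤ/2kℤ with edges {i, i+1}. Then the number of functions f : ℤ/2kℤ → ℤ with f(0) = 0 and |f(i+1) − f(i)| = 1 for all i ∈ ℤ/2kℤ equals the binomial coefficient C(2k, k); equivalently, the number of facet-defining labelings of C_{2k} based at the vertex 0 (and hence the number of facets of the symmetric edge polytope P_{C_{2k}}) equals C(2k, k). -/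
open SimpleGraph

/-- The cycle graph on vertex set `ZMod n`, with edges `{i, i+1}`. -/
def cycleGraphZMod (n : ℕ) : SimpleGraph (ZMod n) :=
  SimpleGraph.fromRel (fun i j => j = i + 1)

open Finset in
theorem ZMod.sum_range_natCast {n : ℕ} [NeZero n] {M : Type*} [AddCommMonoid M] (d : ZMod n → M) :
    ∑ j ∈ range n, d (j : ZMod n) = ∑ i, d i := by
  refine sum_bij' (fun j _ => (j : ZMod n)) (fun i _ => i.val) ?_ ?_ ?_ ?_ ?_
  · simp
  · intro i _
    exact mem_range.2 i.val_lt
  · intro j hj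
    exact ZMod.val_cast_of_lt (mem_range.1 hj)
  · simp
  · simp

theorem ZMod.induction_add_one {n : ℕ} [NeZero n] {p : ZMod n → Prop} (zero : p 0)
    (succ : ∀ i, p i → p (i + 1)) (i : ZMod n) : p i := by
  have h : ∀ m : ℕ, p (m : ZMod n) := fun m => by
    induction m with
    | zero => simpa using zero
    | succ m ih => simpa using succ _ ih
  simpa using h i.val

theorem ZMod.sum_add_one_sub {n : ℕ} [NeZero n] (f : ZMod n → ℤ) :
    ∑ i, (f (i + 1) - f i) = 0 := by
  rw [Finset.sum_sub_distrib, sub_eq_zero]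
  exact Equiv.sum_comp (Equiv.addRight (1 : ZMod n)) f

open Finset in
/-- A function on `ZMod n` with zero sum is a cyclic difference. -/
theorem ZMod.exists_add_one_sub_eq {n : ℕ} [NeZero n] (d : ZMod n → ℤ) (hd : ∑ i, d i = 0) :
    ∃ f : ZMod n → ℤ, f 0 = 0 ∧ ∀ i, f (i + 1) - f i = d i := by
  refine ⟨fun i => ∑ j ∈ range i.val, d (j : ZMod n), by simp, fun i => ?_⟩
  have hs : ∑ j ∈ range (i.val + 1), d (j : ZMod n) = ∑ j ∈ range i.val, d (j : ZMod n) + d i := by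
    simp [sum_range_succ]
  rcases Nat.lt_or_ge (i.val + 1) n with h | h
  · have hv : (i + 1).val = i.val + 1 := by
      have hc : ((i.val + 1 : ℕ) : ZMod n) = i + 1 := by simp
      rw [← hc, ZMod.val_cast_of_lt h]
    simp only [hv, hs]
    ring
  · have hn : i.val + 1 = n := le_antisymm i.val_lt h
    have hi : i + 1 = 0 := by
      have hc : ((i.val + 1 : ℕ) : ZMod n) = i + 1 := by simp
      rw [← hc, hn, ZMod.natCast_self]
    rw [hn, ZMod.sum_range_natCast, hd] at hs
    simp only [hi, ZMod.val_zero, range_zero, sum_empty]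
    linarith

theorem abs_eq_one_iff_eq_ite (x : ℤ) : |x| = 1 ↔ x = if x = 1 then 1 else -1 := by
  split_ifs with h
  · simp [h]
  · rw [abs_eq zero_le_one]
    tauto

open Finset in
theorem ZMod.sum_ite_mem_one_neg_one {n : ℕ} [NeZero n] (S : Finset (ZMod n)) :
    ∑ i, (if i ∈ S then (1 : ℤ) else -1) = 2 * #S - n := by
  have h : ∀ i, (if i ∈ S then (1 : ℤ) else -1) = 2 * (if i ∈ S then 1 else 0) - 1 := by
    intro i
    split_ifs <;> norm_num
  simp only [h, sum_sub_distrib, ← mul_sum]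
  simp [ZMod.card]

open Finset in
theorem card_cyclic_unit_step_functions (k : ℕ) (hk : 0 < k) :
    Nat.card {f : ZMod (2 * k) → ℤ // f 0 = 0 ∧ ∀ i, |f (i + 1) - f i| = 1} =
      Nat.choose (2 * k) k := by
  have : NeZero (2 * k) := ⟨by omega⟩
  have hcard : ∀ f : {f : ZMod (2 * k) → ℤ // f 0 = 0 ∧ ∀ i, |f (i + 1) - f i| = 1},
      #{i | f.1 (i + 1) - f.1 i = 1} = k := by
    rintro ⟨f, h0, h1⟩
    have h := ZMod.sum_ite_mem_one_neg_one ({i | f (i + 1) - f i = 1} : Finset (ZMod (2 * k)))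
    simp only [mem_filter, mem_univ, true_and, ← (abs_eq_one_iff_eq_ite _).1 (h1 _),
      ZMod.sum_add_one_sub] at h
    push_cast at h
    dsimp only
    omega
  have hchoose : Nat.card {S : Finset (ZMod (2 * k)) // #S = k} = Nat.choose (2 * k) k := by
    rw [Nat.card_eq_fintype_card, Fintype.card_finset_len, ZMod.card]
  rw [← hchoose]
  refine Nat.card_eq_of_bijective (fun f => ⟨({i | f.1 (i + 1) - f.1 i = 1} : Finset _), hcard f⟩)
    ⟨?_, ?_⟩
  · rintro ⟨f, hf0, hf⟩ ⟨g, hg0, hg⟩ hfg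
    have hmem : ∀ i, f (i + 1) - f i = 1 ↔ g (i + 1) - g i = 1 := by
      simpa [Finset.ext_iff] using hfg
    refine Subtype.ext (funext (ZMod.induction_add_one (hf0.trans hg0.symm) fun i hi => ?_))
    have h1 := (abs_eq_one_iff_eq_ite _).1 (hf i)
    rw [if_congr (hmem i) rfl rfl, ← (abs_eq_one_iff_eq_ite _).1 (hg i)] at h1
    dsimp only at hi ⊢
    linarith
  · rintro ⟨S, hS⟩
    obtain ⟨f, hf0, hf⟩ := ZMod.exists_add_one_sub_eq (fun i => if i ∈ S then (1 : ℤ) else -1)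
      (by rw [ZMod.sum_ite_mem_one_neg_one, hS]; push_cast; ring)
    refine ⟨⟨f, hf0, fun i => ?_⟩, Subtype.ext (Finset.ext fun i => ?_)⟩
    · rw [hf]
      split_ifs <;> simp
    · simp only [hf, mem_filter, mem_univ, true_and]
      split_ifs with h <;> simp [h]

theorem cycleGraphZMod_adj {n : ℕ} {i j : ZMod n} :
    (cycleGraphZMod n).Adj i j ↔ i ≠ j ∧ (j = i + 1 ∨ i = j + 1) :=
  SimpleGraph.fromRel_adj _ _ _

open Finset in
theorem card_le_card_unit_steps_add_one {n : ℕ} [NeZero n] {f : ZMod n → ℤ}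
    (hf : (labelSubgraph (cycleGraphZMod n) f).Connected) :
    n ≤ #{i | |f (i + 1) - f i| = 1} + 1 := by
  classical
  have h := hf.card_vert_le_card_edgeSet_add_one
  rw [Nat.card_zmod] at h
  refine h.trans (Nat.add_le_add_right ?_ 1)
  have hsub : (labelSubgraph (cycleGraphZMod n) f).edgeSet ⊆
      (({i | |f (i + 1) - f i| = 1} : Finset (ZMod n)).image fun i => s(i, i + 1)) := by
    intro e
    induction e with
    | h u v =>
      rintro ⟨hadj, hd⟩
      rw [coe_image, Set.mem_image]
      dsimp only at hadj hd
      rcases (cycleGraphZMod_adj.1 hadj).2 with rfl | rfl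
      · exact ⟨u, by simpa [abs_sub_comm] using hd, rfl⟩
      · exact ⟨v, by simpa using hd, Sym2.eq_swap⟩
  have := Set.ncard_le_ncard hsub (finite_toSet _)
  rw [Set.ncard_coe_finset] at this
  exact this.trans card_image_le

open Finset in
theorem even_card_unit_steps {n : ℕ} [NeZero n] {f : ZMod n → ℤ}
    (hf : ∀ i, |f (i + 1) - f i| ≤ 1) : Even #{i | |f (i + 1) - f i| = 1} := by
  have habs : (#{i | |f (i + 1) - f i| = 1} : ℤ) = ∑ i, |f (i + 1) - f i| := by
    rw [card_filter]
    push_cast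
    refine sum_congr rfl fun i _ => ?_
    have := hf i
    have := abs_nonneg (f (i + 1) - f i)
    split_ifs <;> omega
  have hdvd : (2 : ℤ) ∣ ∑ i, (|f (i + 1) - f i| - (f (i + 1) - f i)) :=
    dvd_sum fun i _ => by
      rcases abs_choice (f (i + 1) - f i) with h | h <;> rw [h] <;> omega
  rw [sum_sub_distrib, ZMod.sum_add_one_sub, sub_zero, ← habs] at hdvd
  exact even_iff_two_dvd.2 (by exact_mod_cast hdvd)

open Finset in
theorem isFacetLabeling_cycleGraphZMod_iff {k : ℕ} (hk : 0 < k) (f : ZMod (2 * k) → ℤ) :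
    IsFacetLabeling (cycleGraphZMod (2 * k)) 0 f ↔
      f 0 = 0 ∧ ∀ i, |f (i + 1) - f i| = 1 := by
  have : NeZero (2 * k) := ⟨by omega⟩
  have : Fact (1 < 2 * k) := ⟨by omega⟩
  have hstep : ∀ i, (cycleGraphZMod (2 * k)).Adj i (i + 1) := fun i =>
    cycleGraphZMod_adj.2 ⟨by simp, Or.inl rfl⟩
  refine and_congr_right fun _ => ⟨fun ⟨hle, hconn⟩ => ?_, fun h1 => ⟨?_, ?_⟩⟩
  · have heven := even_card_unit_steps fun i => hle _ _ (hstep i).symm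
    have hlow := card_le_card_unit_steps_add_one hconn
    have hup := card_filter_le (univ : Finset (ZMod (2 * k))) (fun i => |f (i + 1) - f i| = 1)
    have huniv : #(univ : Finset (ZMod (2 * k))) = 2 * k := by rw [card_univ, ZMod.card]
    obtain ⟨m, hm⟩ := heven
    have := card_filter_eq_iff.1
      (show #{i | |f (i + 1) - f i| = 1} = #(univ : Finset (ZMod (2 * k))) by omega)
    exact fun i => this i (mem_univ i)
  · intro u v huv
    rcases (cycleGraphZMod_adj.1 huv).2 with rfl | rfl
    · rw [abs_sub_comm, h1]
    · rw [h1]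
  · refine (SimpleGraph.connected_iff_exists_forall_reachable _).2
      ⟨0, ZMod.induction_add_one (SimpleGraph.Reachable.refl _) fun i hi => hi.trans ?_⟩
    exact SimpleGraph.Adj.reachable ⟨hstep i, by rw [abs_sub_comm, h1]⟩

/-- For `k ≥ 2`, the number of functions `f : ℤ/2kℤ → ℤ` with `f 0 = 0`
and `|f (i+1) - f i| = 1` for all `i` equals `C(2k, k)`; equivalently, the number of
facet-defining labelings of the even cycle `C_{2k}` based at `0` equals `C(2k, k)`. -/
theorem stmt4 (k : ℕ) (hk : 2 ≤ k) :
    Nat.card {f : ZMod (2 * k) → ℤ // f 0 = 0 ∧ ∀ i, |f (i + 1) - f i| = 1} =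
      Nat.choose (2 * k) k ∧
    Nat.card {f : ZMod (2 * k) → ℤ // IsFacetLabeling (cycleGraphZMod (2 * k)) 0 f} =
      Nat.choose (2 * k) k := by
  have hk0 : 0 < k := by omega
  refine ⟨card_cyclic_unit_step_functions k hk0, ?_⟩
  rw [← card_cyclic_unit_step_functions k hk0]
  exact Nat.card_congr (Equiv.subtypeEquivRight (isFacetLabeling_cycleGraphZMod_iff hk0))
end

section
/- Let G1 = (V1, E1) and G2 = (V2, E2) be finite simple connected bipartite graphs such that V1 ∩ V2 = {v, w}, the pair {v,w} is an edge of both graphs, and E1 ∩ E2 = {{v,w}}; let G = (V1 ∪ V2, E1 ∪ E2) be the graph obtained by identifying this common edge. If N, N1, N2 denote the numbers of facet-defining labelings based at v of G, G1 and G2 respectively, then 2·N = N1·N2. (Equivalently, the number of facets of P_G equals half the product of the numbers of facets of P_{G1} and P_{G2}.) -/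
open SimpleGraph

/-- A labeling vanishing at `v0` whose values differ by exactly one along every edge. -/
def IsUnitLabeling {V : Type*} (G : SimpleGraph V) (v0 : V) (f : V → ℤ) : Prop :=
  f v0 = 0 ∧ ∀ a b, G.Adj a b → |f a - f b| = 1

/-- A `ZMod 2`-valued function changing along every edge can be chosen to vanish at a given
vertex of a 2-colorable graph. -/
theorem exists_parity_of_colorable {V : Type*} {G : SimpleGraph V} (hG : G.Colorable 2) (v : V) :
    ∃ p : V → ZMod 2, p v = 0 ∧ ∀ a b, G.Adj a b → p a - p b = 1 := by
  obtain ⟨c⟩ := hG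
  let q : V → ZMod 2 := c
  have key : ∀ x y z : ZMod 2, x ≠ y → (x - z) - (y - z) = 1 := by decide
  exact ⟨fun x => q x - q v, sub_self _, fun a b hab => key _ _ _ (c.valid hab)⟩

theorem intCast_zmod_two_of_abs_eq_one {n : ℤ} (hn : |n| = 1) : (n : ZMod 2) = 1 := by
  rcases (abs_eq zero_le_one).1 hn with rfl | rfl <;> decide

theorem abs_eq_one_of_intCast_zmod_two {n : ℤ} (hle : |n| ≤ 1) (hn : (n : ZMod 2) = 1) :
    |n| = 1 := by
  rw [abs_le] at hle
  obtain ⟨h1, h2⟩ := hle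
  interval_cases n
  · rfl
  · simp at hn
  · rfl

/-- On a connected bipartite graph every edge is tight for a facet-defining labeling. -/
theorem isFacetLabeling_iff_isUnitLabeling {V : Type*} {G : SimpleGraph V} (hc : G.Connected)
    {p : V → ZMod 2} (hp : ∀ a b, G.Adj a b → p a - p b = 1) (v0 : V) (f : V → ℤ) :
    IsFacetLabeling G v0 f ↔ IsUnitLabeling G v0 f := by
  constructor
  · rintro ⟨h0, hle, hconn⟩
    have hconst : ∀ a b, ((f a : ℤ) : ZMod 2) - p a = (f b : ℤ) - p b := by
      intro a b
      obtain ⟨walk⟩ := hconn.preconnected a b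
      induction walk with
      | nil => rfl
      | cons h _ ih =>
        have h1 := intCast_zmod_two_of_abs_eq_one h.2
        have h2 := hp _ _ h.1
        push_cast at h1
        rw [← ih]
        linear_combination h1 - h2
    refine ⟨h0, fun a b hab => abs_eq_one_of_intCast_zmod_two (hle a b hab) ?_⟩
    push_cast
    linear_combination hconst a b + hp a b hab
  · rintro ⟨h0, h⟩
    have heq : labelSubgraph G f = G := by
      ext a b
      exact ⟨fun hab => hab.1, fun hab => ⟨hab, h a b hab⟩⟩
    exact ⟨h0, fun a b hab => (h a b hab).le, by rwa [heq]⟩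

theorem IsUnitLabeling.neg {V : Type*} {G : SimpleGraph V} {v0 : V} {f : V → ℤ}
    (hf : IsUnitLabeling G v0 f) : IsUnitLabeling G v0 (-f) := by
  refine ⟨by simp [hf.1], fun a b hab => ?_⟩
  rw [← hf.2 a b hab, ← abs_neg]
  congr 1
  simp only [Pi.neg_apply]
  ring

/-- Negation pairs up the unit labelings taking the value `1` and `-1` at a neighbor `w` of the
base vertex. -/
theorem card_isUnitLabeling {V : Type*} {G : SimpleGraph V} {v w : V} (hvw : G.Adj v w) :
    Nat.card {f : V → ℤ // IsUnitLabeling G v f} =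
      2 * Nat.card {f : V → ℤ // IsUnitLabeling G v f ∧ f w = 1} := by
  have hval : ∀ f, IsUnitLabeling G v f → f w = 1 ∨ f w = -1 := by
    intro f hf
    have h := hf.2 v w hvw
    rw [hf.1, zero_sub, abs_neg] at h
    exact (abs_eq zero_le_one).1 h
  let e : {f : V → ℤ // IsUnitLabeling G v f} ≃
      Bool × {f : V → ℤ // IsUnitLabeling G v f ∧ f w = 1} :=
    { toFun := fun f => if h : f.1 w = 1 then (true, ⟨f.1, f.2, h⟩) else
        (false, ⟨-f.1, f.2.neg, by
          rw [Pi.neg_apply, (hval f.1 f.2).resolve_left h, neg_neg]⟩)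
      invFun := fun x => bif x.1 then ⟨x.2.1, x.2.2.1⟩ else ⟨-x.2.1, x.2.2.1.neg⟩
      left_inv := by
        intro f
        by_cases h : f.1 w = 1 <;> simp [h]
      right_inv := by
        rintro ⟨b, f, hf, hw⟩
        cases b <;> simp [hw] }
  rw [Nat.card_congr e, Nat.card_prod]
  simp

/-- Two vertices of a connected induced subgraph are reachable in any larger graph. -/
theorem reachable_of_induce_connected {V : Type*} {H G : SimpleGraph V} (hle : H ≤ G) {s : Set V}
    (hc : (H.induce s).Connected) {a b : V} (ha : a ∈ s) (hb : b ∈ s) : G.Reachable a b :=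
  ((hc.preconnected ⟨a, ha⟩ ⟨b, hb⟩).map (Embedding.induce s).toHom).mono hle

/-- Functions on two sets covering the whole type and agreeing on their intersection glue. -/
theorem exists_glue {V α : Type*} {V1 V2 : Set V} (hcover : V1 ∪ V2 = Set.univ)
    (f1 : V1 → α) (f2 : V2 → α) (h : ∀ x (h1 : x ∈ V1) (h2 : x ∈ V2), f1 ⟨x, h1⟩ = f2 ⟨x, h2⟩) :
    ∃ f : V → α, (∀ x : V1, f x = f1 x) ∧ ∀ x : V2, f x = f2 x := by
  classical
  have hmem : ∀ x, x ∉ V1 → x ∈ V2 := fun x hx =>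
    ((Set.mem_union _ _ _).1 (hcover ▸ Set.mem_univ x)).resolve_left hx
  refine ⟨fun x => if hx : x ∈ V1 then f1 ⟨x, hx⟩ else f2 ⟨x, hmem x hx⟩, ?_, ?_⟩
  · rintro ⟨x, hx⟩
    simp [hx]
  · rintro ⟨x, hx⟩
    by_cases hx1 : x ∈ V1
    · simp [hx1, h x hx1 hx]
    · simp [hx1]

/-- Unit labelings of a graph glued along an edge, positive on that edge, are pairs of such
labelings of the two parts. -/
theorem card_isUnitLabeling_sup {V : Type*} {G1 G2 : SimpleGraph V} {V1 V2 : Set V} {v w : V}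
    (hcover : V1 ∪ V2 = Set.univ) (hinter : V1 ∩ V2 = {v, w})
    (hE1 : ∀ a b, G1.Adj a b → a ∈ V1 ∧ b ∈ V1) (hE2 : ∀ a b, G2.Adj a b → a ∈ V2 ∧ b ∈ V2)
    (hv1 : v ∈ V1) (hv2 : v ∈ V2) (hw1 : w ∈ V1) (hw2 : w ∈ V2) :
    Nat.card {f : V → ℤ // IsUnitLabeling (G1 ⊔ G2) v f ∧ f w = 1} =
      Nat.card {f : V1 → ℤ // IsUnitLabeling (G1.induce V1) ⟨v, hv1⟩ f ∧ f ⟨w, hw1⟩ = 1} *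
      Nat.card {f : V2 → ℤ // IsUnitLabeling (G2.induce V2) ⟨v, hv2⟩ f ∧ f ⟨w, hw2⟩ = 1} := by
  rw [← Nat.card_prod]
  refine Nat.card_congr (Equiv.ofBijective (fun f =>
    (⟨fun x => f.1 x, ⟨f.2.1.1, fun a b hab => f.2.1.2 a b (Or.inl hab)⟩, f.2.2⟩,
      ⟨fun x => f.1 x, ⟨f.2.1.1, fun a b hab => f.2.1.2 a b (Or.inr hab)⟩, f.2.2⟩)) ⟨?_, ?_⟩)
  · rintro ⟨f, hf⟩ ⟨g, hg⟩ hfg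
    simp only [Prod.mk.injEq, Subtype.mk.injEq] at hfg
    refine Subtype.ext (funext fun x => ?_)
    rcases (Set.mem_union _ _ _).1 (hcover ▸ Set.mem_univ x) with hx | hx
    · exact congrFun hfg.1 ⟨x, hx⟩
    · exact congrFun hfg.2 ⟨x, hx⟩
  · rintro ⟨⟨f1, hf1, hfw1⟩, ⟨f2, hf2, hfw2⟩⟩
    obtain ⟨f, h1, h2⟩ := exists_glue hcover f1 f2 (by
      intro x hx1 hx2
      have hx : x ∈ ({v, w} : Set V) := hinter ▸ ⟨hx1, hx2⟩
      rcases hx with rfl | rfl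
      · exact hf1.1.trans hf2.1.symm
      · exact hfw1.trans hfw2.symm)
    refine ⟨⟨f, ⟨(h1 ⟨v, hv1⟩).trans hf1.1, ?_⟩, (h1 ⟨w, hw1⟩).trans hfw1⟩, ?_⟩
    · rintro a b (hab | hab)
      · obtain ⟨ha, hb⟩ := hE1 a b hab
        rw [h1 ⟨a, ha⟩, h1 ⟨b, hb⟩]
        exact hf1.2 ⟨a, ha⟩ ⟨b, hb⟩ hab
      · obtain ⟨ha, hb⟩ := hE2 a b hab
        rw [h2 ⟨a, ha⟩, h2 ⟨b, hb⟩]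
        exact hf2.2 ⟨a, ha⟩ ⟨b, hb⟩ hab
    · exact Prod.ext (Subtype.ext (funext h1)) (Subtype.ext (funext h2))

/-- Let `G1` (on vertex set `V1`) and `G2` (on vertex set `V2`) be
finite simple connected bipartite graphs with `V1 ∩ V2 = {v, w}`, the pair `{v, w}`
an edge of both, and this the only common edge; let `G = G1 ∪ G2` be the graph
obtained by identifying this common edge. Then twice the number of facet-defining
labelings of `G` based at `v` is the product of the corresponding numbers for
`G1` and `G2`; equivalently, the number of facets of `P_G` is half the product
of the numbers of facets of `P_{G1}` and `P_{G2}`. -/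
theorem stmt7 {V : Type*} [Fintype V] [DecidableEq V]
    (G1 G2 : SimpleGraph V) (V1 V2 : Set V) (v w : V) (hvw : v ≠ w)
    (hcover : V1 ∪ V2 = Set.univ)
    (hinter : V1 ∩ V2 = {v, w})
    (hE1 : ∀ a b, G1.Adj a b → a ∈ V1 ∧ b ∈ V1)
    (hE2 : ∀ a b, G2.Adj a b → a ∈ V2 ∧ b ∈ V2)
    (hvw1 : G1.Adj v w) (hvw2 : G2.Adj v w)
    (hEinter : ∀ a b, G1.Adj a b → G2.Adj a b → (a = v ∧ b = w) ∨ (a = w ∧ b = v))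
    (hconn1 : (G1.induce V1).Connected) (hconn2 : (G2.induce V2).Connected)
    (hbip1 : G1.Colorable 2) (hbip2 : G2.Colorable 2)
    (hv1 : v ∈ V1) (hv2 : v ∈ V2) :
    2 * Nat.card {f : V → ℤ // IsFacetLabeling (G1 ⊔ G2) v f} =
      Nat.card {f : V1 → ℤ // IsFacetLabeling (G1.induce V1) ⟨v, hv1⟩ f} *
      Nat.card {f : V2 → ℤ // IsFacetLabeling (G2.induce V2) ⟨v, hv2⟩ f} := by
  obtain ⟨hw1, hw2⟩ : w ∈ V1 ∩ V2 := hinter ▸ Or.inr rfl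
  obtain ⟨p1, hp1v, hp1⟩ := exists_parity_of_colorable hbip1 v
  obtain ⟨p2, hp2v, hp2⟩ := exists_parity_of_colorable hbip2 v
  obtain ⟨p, hpV1, hpV2⟩ := exists_glue hcover (fun x : V1 => p1 x) (fun x : V2 => p2 x) (by
    intro x hx1 hx2
    have hx : x ∈ ({v, w} : Set V) := hinter ▸ ⟨hx1, hx2⟩
    rcases hx with rfl | rfl
    · exact hp1v.trans hp2v.symm
    · linear_combination hp2 _ _ hvw2 - hp1 _ _ hvw1 + hp1v - hp2v)
  have hp : ∀ a b, (G1 ⊔ G2).Adj a b → p a - p b = 1 := by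
    rintro a b (hab | hab)
    · obtain ⟨ha, hb⟩ := hE1 a b hab
      rw [hpV1 ⟨a, ha⟩, hpV1 ⟨b, hb⟩]
      exact hp1 a b hab
    · obtain ⟨ha, hb⟩ := hE2 a b hab
      rw [hpV2 ⟨a, ha⟩, hpV2 ⟨b, hb⟩]
      exact hp2 a b hab
  have hreach : ∀ x, (G1 ⊔ G2).Reachable v x := by
    intro x
    rcases (Set.mem_union _ _ _).1 (hcover ▸ Set.mem_univ x) with hx | hx
    · exact reachable_of_induce_connected le_sup_left hconn1 hv1 hx
    · exact reachable_of_induce_connected le_sup_right hconn2 hv2 hx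
  have hconn : (G1 ⊔ G2).Connected :=
    { preconnected := fun a b => (hreach a).symm.trans (hreach b)
      nonempty := ⟨v⟩ }
  simp only [isFacetLabeling_iff_isUnitLabeling hconn hp,
    isFacetLabeling_iff_isUnitLabeling hconn1 (p := fun x => p1 x) (fun a b hab => hp1 a b hab),
    isFacetLabeling_iff_isUnitLabeling hconn2 (p := fun x => p2 x) (fun a b hab => hp2 a b hab)]
  have hadj1 : (G1.induce V1).Adj ⟨v, hv1⟩ ⟨w, hw1⟩ := hvw1
  have hadj2 : (G2.induce V2).Adj ⟨v, hv2⟩ ⟨w, hw2⟩ := hvw2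
  have hadj : (G1 ⊔ G2).Adj v w := Or.inl hvw1
  rw [card_isUnitLabeling hadj, card_isUnitLabeling hadj1, card_isUnitLabeling hadj2,
    card_isUnitLabeling_sup hcover hinter hE1 hE2 hv1 hv2 hw1 hw2]
  ring
end

section
/- Let k ≥ 1 and a_1, …, a_k ≥ 2, and let H be a graph obtained from even cycles of lengths 2a_1, …, 2a_k by, for each i = 2, …, k, gluing the cycle of length 2a_i to the previously constructed graph along a single edge of the cycle of length 2a_{i−1} (identifying one edge of the new cycle, together with its two endpoints, with one edge of the previous cycle). Then for any fixed vertex v0 of H, the number of facet-defining labelings of H based at v0 (equivalently, the number of facets of the symmetric edge polytope P_H) equals (1/2^{k−1}) · ∏_{i=1}^{k} C(2a_i, a_i). -/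
open SimpleGraph

/-- Integer labelings supported on `U`, vanishing at `b`, that change by exactly one along every
pair related by `E`. -/
def unitStepLabelings {V : Type*} (U : Set V) (E : V → V → Prop) (b : V) : Set (V → ℤ) :=
  {f | (∀ v, v ∉ U → f v = 0) ∧ f b = 0 ∧ ∀ u v, E u v → |f v - f u| = 1}

/-- Closed walks of length `n` on `ℤ` with unit steps, whose first step goes from `0` to `1`. -/
def closedUnitWalks (n : ℕ) : Set (ZMod n → ℤ) :=
  {w | w 0 = 0 ∧ w 1 = 1 ∧ ∀ x, |w (x + 1) - w x| = 1}

/-- The height after `m` steps of the walk whose up-steps are the elements of `T`. -/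
def walkHeight (T : Finset ℕ) (m : ℕ) : ℤ :=
  ∑ j ∈ Finset.range m, if j ∈ T then 1 else -1

theorem walkHeight_succ (T : Finset ℕ) (m : ℕ) :
    walkHeight T (m + 1) = walkHeight T m + if m ∈ T then 1 else -1 := by
  simp [walkHeight, Finset.sum_range_succ]

theorem walkHeight_of_subset {T : Finset ℕ} {m : ℕ} (h : T ⊆ Finset.range m) :
    walkHeight T m = 2 * (T.card : ℤ) - m := by
  have h1 : ∀ j ∈ Finset.range m,
      (if j ∈ T then (1 : ℤ) else -1) = 2 * (if j ∈ T then 1 else 0) - 1 := by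
    intro j _; split_ifs <;> norm_num
  rw [walkHeight, Finset.sum_congr rfl h1, Finset.sum_sub_distrib, ← Finset.mul_sum,
    Finset.sum_ite_mem, Finset.inter_eq_right.mpr h]
  simp

theorem ZMod.val_add_one_eq_ite {n : ℕ} [NeZero n] (hn : 1 < n) (x : ZMod n) :
    (x + 1).val = if x.val + 1 = n then 0 else x.val + 1 := by
  have : Fact (1 < n) := ⟨hn⟩
  have hx := x.val_lt
  rw [ZMod.val_add, ZMod.val_one]
  split_ifs with h
  · rw [h, Nat.mod_self]
  · exact Nat.mod_eq_of_lt (by omega)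

theorem two_mul_card_closedUnitWalks {a : ℕ} (ha : 1 ≤ a) :
    2 * Nat.card (closedUnitWalks (2 * a)) = Nat.choose (2 * a) a := by
  obtain ⟨m, rfl⟩ : ∃ m, a = m + 1 := ⟨a - 1, by omega⟩
  set n := 2 * (m + 1) with hn
  have : NeZero n := ⟨by omega⟩
  have hfact : Fact (1 < n) := ⟨by omega⟩
  let S := (Finset.Ico 1 n).powersetCard m
  have hsub : ∀ T ∈ S, insert 0 T ⊆ Finset.range n := by
    intro T hT j hj
    have := (Finset.mem_powersetCard.mp hT).1
    rcases Finset.mem_insert.mp hj with rfl | hj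
    · simp; omega
    · have := Finset.mem_Ico.mp (this hj); simp; omega
  have hz : ∀ T ∈ S, 0 ∉ T := fun T hT h => by
    have := Finset.mem_Ico.mp ((Finset.mem_powersetCard.mp hT).1 h); omega
  have htot : ∀ T ∈ S, walkHeight (insert 0 T) n = 0 := by
    intro T hT
    rw [walkHeight_of_subset (hsub T hT), Finset.card_insert_of_notMem (hz T hT),
      (Finset.mem_powersetCard.mp hT).2, hn]
    push_cast; ring
  let F : S → closedUnitWalks n := fun T =>
    ⟨fun x => walkHeight (insert 0 T.1) x.val, by
      refine ⟨by simp [walkHeight], by simp [walkHeight, ZMod.val_one], fun x => ?_⟩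
      have hs := walkHeight_succ (insert 0 T.1) x.val
      have h1 : walkHeight (insert 0 T.1) (x + 1).val
          = walkHeight (insert 0 T.1) (x.val + 1) := by
        rw [ZMod.val_add_one_eq_ite (by omega)]
        split_ifs with h
        · rw [h, htot T.1 T.2]; simp [walkHeight]
        · rfl
      beta_reduce
      rw [h1, hs]
      split_ifs <;> simp⟩
  have hF : Function.Bijective F := by
    constructor
    · rintro ⟨T, hT⟩ ⟨T', hT'⟩ h
      have hw : ∀ j ≤ n, walkHeight (insert 0 T) j = walkHeight (insert 0 T') j := by
        intro j hj
        rcases hj.lt_or_eq with hj | rfl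
        · have := congrFun (congrArg Subtype.val h) (j : ZMod n)
          simpa [F, ZMod.val_cast_of_lt hj] using this
        · rw [htot T hT, htot T' hT']
      have hins : insert 0 T = insert 0 T' := by
        ext j
        by_cases hj : j < n
        · have h1 := hw j hj.le
          have h2 := hw (j + 1) hj
          rw [walkHeight_succ, walkHeight_succ, h1] at h2
          by_cases hjT : j ∈ insert 0 T <;> by_cases hjT' : j ∈ insert 0 T' <;>
            simp [hjT, hjT'] at h2 ⊢
        · exact iff_of_false (fun h => hj (Finset.mem_range.mp (hsub T hT h)))
            (fun h => hj (Finset.mem_range.mp (hsub T' hT' h)))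
      apply Subtype.ext
      have := congrArg (fun A => Finset.erase A 0) hins
      simpa [Finset.erase_insert (hz T hT), Finset.erase_insert (hz T' hT')] using this
    · rintro ⟨w, hw0, hw1, hw⟩
      let T := (Finset.Ico 1 n).filter fun j : ℕ => w (j + 1) - w j = 1
      have hh : ∀ j ≤ n, walkHeight (insert 0 T) j = w j := by
        intro j hj
        induction j with
        | zero => simp [walkHeight, hw0]
        | succ j ih =>
          rw [walkHeight_succ, ih (by omega)]
          have hmem : j ∈ insert 0 T ↔ w (j + 1) - w j = 1 := by
            rcases Nat.eq_zero_or_pos j with rfl | hj0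
            · simp [hw0, hw1]
            · simp [T]; omega
          have := hw j
          rw [abs_eq zero_le_one] at this
          push_cast
          by_cases h : j ∈ insert 0 T
          · rw [if_pos h]; have := hmem.mp h; omega
          · rw [if_neg h]; have := mt hmem.mpr h; omega
      have hT0 : 0 ∉ T := by simp [T]
      have hTs : insert 0 T ⊆ Finset.range n := by
        intro j hj
        simp only [T, Finset.mem_insert, Finset.mem_filter, Finset.mem_Ico] at hj
        simp; omega
      have hTS : T ∈ S := by
        refine Finset.mem_powersetCard.mpr ⟨Finset.filter_subset _ _, ?_⟩
        have h1 := hh n le_rfl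
        rw [walkHeight_of_subset hTs, ZMod.natCast_self, hw0,
          Finset.card_insert_of_notMem hT0] at h1
        omega
      refine ⟨⟨T, hTS⟩, Subtype.ext (funext fun x => ?_)⟩
      have := hh x.val x.val_lt.le
      simpa [F] using this
  rw [← Nat.card_eq_of_bijective F hF, Nat.card_eq_fintype_card, Fintype.card_coe,
    Finset.card_powersetCard, Nat.card_Ico, hn, show 2 * (m + 1) - 1 = 2 * m + 1 by omega,
    show 2 * (m + 1) = (2 * m + 1) + 1 by ring, Nat.choose_succ_succ,
    Nat.choose_symm_half, two_mul]

theorem card_unitStepLabelings_glue {V : Type*} {U : Set V} {E : V → V → Prop} {b : V} {n : ℕ}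
    (hb : b ∈ U) (hE : ∀ u v, E u v → u ∈ U ∧ v ∈ U) (c : ZMod n → V)
    (hc : Function.Injective c) (hU : ∀ z, c z ∈ U ↔ z = 0 ∨ z = 1)
    (hpq : E (c 0) (c 1) ∨ E (c 1) (c 0)) :
    Nat.card (unitStepLabelings (U ∪ Set.range c)
        (fun u v => E u v ∨ ∃ z, c z = u ∧ c (z + 1) = v) b) =
      Nat.card (unitStepLabelings U E b) * Nat.card (closedUnitWalks n) := by
  classical
  rw [← Nat.card_prod]
  have habs : ∀ f : V → ℤ, (∀ u v, E u v → |f v - f u| = 1) →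
      f (c 1) - f (c 0) = 1 ∨ f (c 1) - f (c 0) = -1 := by
    intro f hf
    rcases hpq with h | h
    · exact (abs_eq zero_le_one).mp (hf _ _ h)
    · have := (abs_eq zero_le_one).mp (hf _ _ h); omega
  have h0 : c 0 ∈ U := (hU 0).mpr (.inl rfl)
  have h1 : c 1 ∈ U := (hU 1).mpr (.inr rfl)
  let ext : (V → ℤ) → (ZMod n → ℤ) → V → ℤ := fun g w v =>
    if v ∈ U then g v
    else Function.extend c (fun z => g (c 0) + (g (c 1) - g (c 0)) * w z) 0 v
  have ext_mem : ∀ g w v, v ∈ U → ext g w v = g v := fun g w v hv => if_pos hv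
  have ext_cycle : ∀ g w, w 0 = 0 → w 1 = 1 → ∀ z,
      ext g w (c z) = g (c 0) + (g (c 1) - g (c 0)) * w z := by
    intro g w hw0 hw1 z
    by_cases hz : c z ∈ U
    · rw [ext_mem g w _ hz]
      rcases (hU z).mp hz with rfl | rfl
      · rw [hw0]; ring
      · rw [hw1]; ring
    · simp only [ext, if_neg hz, hc.extend_apply]
  refine Nat.card_congr
    { toFun := fun f => (⟨fun v => if v ∈ U then f.1 v else 0, ?_, ?_, ?_⟩,
        ⟨fun z => (f.1 (c 1) - f.1 (c 0)) * (f.1 (c z) - f.1 (c 0)), ?_, ?_, ?_⟩)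
      invFun := fun gw => ⟨ext gw.1.1 gw.2.1, ?_, ?_, ?_⟩
      left_inv := ?_
      right_inv := ?_ }
  · intro v hv; simp [hv]
  · simp [hb, f.2.2.1]
  · intro u v huv
    simp only [hE u v huv, if_true]
    exact f.2.2.2 u v (.inl huv)
  · simp
  · rcases habs f.1 (fun u v h => f.2.2.2 u v (.inl h)) with h | h <;> simp only [h] <;> norm_num
  · intro z
    have hz := f.2.2.2 _ _ (.inr ⟨z, rfl, rfl⟩)
    rw [← hz]
    rcases habs f.1 (fun u v h => f.2.2.2 u v (.inl h)) with h | h <;> rw [h]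
    · congr 1; ring
    · rw [← abs_neg]; congr 1; ring
  · intro v hv
    have hv1 : v ∉ U := fun h => hv (.inl h)
    have hv2 : ¬ ∃ z, c z = v := fun h => hv (.inr h)
    simp [ext, hv1, Function.extend_apply' _ _ _ hv2]
  · rw [ext_mem _ _ _ hb, gw.1.2.2.1]
  · rintro u v (h | ⟨z, rfl, rfl⟩)
    · rw [ext_mem _ _ _ (hE u v h).1, ext_mem _ _ _ (hE u v h).2]
      exact gw.1.2.2.2 u v h
    · rw [ext_cycle _ _ gw.2.2.1 gw.2.2.2.1, ext_cycle _ _ gw.2.2.1 gw.2.2.2.1]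
      rw [← gw.2.2.2.2 z]
      rcases habs gw.1.1 gw.1.2.2.2 with h | h <;> rw [h]
      · congr 1; ring
      · rw [← abs_neg]; congr 1; ring
  · intro f
    apply Subtype.ext
    funext v
    by_cases hv : v ∈ U
    · simp [ext, hv]
    by_cases hz : ∃ z, c z = v
    · obtain ⟨z, rfl⟩ := hz
      simp only [ext, if_neg hv, hc.extend_apply, if_pos h0, if_pos h1]
      rcases habs f.1 (fun u v h => f.2.2.2 u v (.inl h)) with h | h <;> rw [h] <;> ring
    · simp only [ext, if_neg hv, Function.extend_apply' _ _ _ hz, Pi.zero_apply]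
      exact (f.2.1 v (by rintro (h | h); exacts [hv h, hz h])).symm
  · rintro ⟨g, w⟩
    apply Prod.ext
    · apply Subtype.ext
      funext v
      by_cases hv : v ∈ U
      · simp [ext, hv]
      · simp [hv, g.2.1 v hv]
    · apply Subtype.ext
      funext z
      simp only [ext_cycle g.1 w.1 w.2.1 w.2.2.1, w.2.1, w.2.2.1]
      rcases habs g.1 g.2.2.2 with h | h <;> rw [h] <;> ring

theorem card_unitStepLabelings_edge {V : Type*} {p q : V} (hpq : p ≠ q) :
    Nat.card (unitStepLabelings {p, q} (fun u v => u = p ∧ v = q) p) = 2 := by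
  classical
  have : unitStepLabelings {p, q} (fun u v => u = p ∧ v = q) p =
      {Pi.single q 1, Pi.single q (-1)} := by
    ext f
    simp only [unitStepLabelings, Set.mem_ofPred_eq, Set.mem_insert_iff, Set.mem_singleton_iff]
    constructor
    · rintro ⟨hf, hp, h⟩
      have h := h p q ⟨rfl, rfl⟩
      rw [hp, sub_zero, abs_eq zero_le_one] at h
      refine h.imp (fun h => ?_) (fun h => ?_) <;>
      · funext v
        by_cases hq : v = q
        · subst hq; simpa using h
        · rw [Pi.single_eq_of_ne hq]
          by_cases hvp : v = p
          · rw [hvp, hp]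
          · exact hf v (by tauto)
    · rintro (rfl | rfl) <;>
      · refine ⟨fun v hv => Pi.single_eq_of_ne (by tauto) _, Pi.single_eq_of_ne hpq _, ?_⟩
        rintro u v ⟨rfl, rfl⟩
        simp [hpq]
  rw [this, Nat.card_coe_set_eq, Set.ncard_pair]
  intro h
  have := congrFun h q
  simp at this

/-- In a connected graph carrying a labeling with unit steps along all edges, the facet-defining
labelings are exactly the labelings with unit steps along all edges. -/
theorem isFacetLabeling_iff_of_unitStep {V : Type*} {G : SimpleGraph V} (hG : G.Connected)
    {g : V → ℤ} (hg : ∀ u v, G.Adj u v → |g u - g v| = 1) (v0 : V) (f : V → ℤ) :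
    IsFacetLabeling G v0 f ↔ f v0 = 0 ∧ ∀ u v, G.Adj u v → |f u - f v| = 1 := by
  constructor
  · rintro ⟨h0, hle, hconn⟩
    refine ⟨h0, fun u v huv => ?_⟩
    have key : ∀ x y, (labelSubgraph G f).Walk x y → (2 : ℤ) ∣ (f x - g x) - (f y - g y) := by
      intro x y p
      induction p with
      | nil => simp
      | cons h _ ih =>
        have h1 := (abs_eq zero_le_one).mp h.2
        have h2 := (abs_eq zero_le_one).mp (hg _ _ h.1)
        omega
    obtain ⟨p⟩ := hconn.preconnected u v
    have h1 := key u v p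
    have h2 := (abs_eq zero_le_one).mp (hg _ _ huv)
    have h3 := abs_le.mp (hle u v huv)
    rw [abs_eq zero_le_one]
    omega
  · rintro ⟨h0, h⟩
    have : labelSubgraph G f = G := by
      ext u v
      exact ⟨fun h => h.1, fun huv => ⟨huv, h u v huv⟩⟩
    exact ⟨h0, fun u v huv => (h u v huv).le, by rwa [this]⟩

theorem reachable_of_adj_add_one {V : Type*} {G : SimpleGraph V} {n : ℕ} [NeZero n]
    {c : ZMod n → V} (h : ∀ x, G.Adj (c x) (c (x + 1))) (x y : ZMod n) :
    G.Reachable (c x) (c y) := by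
  have key : ∀ j : ℕ, G.Reachable (c x) (c (x + j)) := by
    intro j
    induction j with
    | zero => simp
    | succ j ih =>
      have := ih.trans (h (x + j)).reachable
      simpa [add_assoc] using this
  simpa using key (y - x).val

/-- Let `H` be a graph obtained by consecutively gluing even cycles
of lengths `2a_1, …, 2a_k` (each `a_i ≥ 2`) along single edges: the `i`-th cycle is
given by an injective map `emb i : ℤ/2a_iℤ → V`, the edges of `H` are exactly the
cycle edges, consecutive cycles share exactly one edge (with its endpoints), and
non-consecutive cycles are disjoint. Then the number of facet-defining labelings of
`H` based at any fixed vertex `v0` (equivalently, the number of facets of `P_H`),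
multiplied by `2^(k-1)`, equals `∏ᵢ C(2a_i, a_i)`. -/
theorem stmt8 {V : Type*} [Fintype V] (H : SimpleGraph V) (k : ℕ) (hk : 1 ≤ k)
    (a : Fin k → ℕ) (ha : ∀ i, 2 ≤ a i)
    (emb : ∀ i : Fin k, ZMod (2 * a i) → V)
    (hinj : ∀ i, Function.Injective (emb i))
    (hcover : ∀ v : V, ∃ i x, emb i x = v)
    (hadj : ∀ u v : V, H.Adj u v ↔
      ∃ i x, (emb i x = u ∧ emb i (x + 1) = v) ∨ (emb i x = v ∧ emb i (x + 1) = u))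
    (hconsec : ∀ i : Fin k, ∀ h : (i : ℕ) + 1 < k,
      ∃ x y, Set.range (emb i) ∩ Set.range (emb ⟨(i : ℕ) + 1, h⟩) =
          {emb i x, emb i (x + 1)} ∧
        ((emb ⟨(i : ℕ) + 1, h⟩ y = emb i x ∧
            emb ⟨(i : ℕ) + 1, h⟩ (y + 1) = emb i (x + 1)) ∨
         (emb ⟨(i : ℕ) + 1, h⟩ y = emb i (x + 1) ∧
            emb ⟨(i : ℕ) + 1, h⟩ (y + 1) = emb i x)))
    (hfar : ∀ i j : Fin k, (i : ℕ) + 1 < (j : ℕ) →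
      Set.range (emb i) ∩ Set.range (emb j) = ∅)
    (v0 : V) :
    2 ^ (k - 1) * Nat.card {f : V → ℤ // IsFacetLabeling H v0 f} =
      ∏ i : Fin k, Nat.choose (2 * a i) (a i) := by
  have hne : ∀ i, NeZero (2 * a i) := fun i => ⟨by have := ha i; omega⟩
  have hfact : ∀ i, Fact (1 < 2 * a i) := fun i => ⟨by have := ha i; omega⟩
  have hcyc : ∀ i x, H.Adj (emb i x) (emb i (x + 1)) := fun i x =>
    (hadj _ _).mpr ⟨i, x, .inl ⟨rfl, rfl⟩⟩
  let o : Fin k := ⟨0, hk⟩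
  let U : ℕ → Set V := fun n =>
    {v | v ∈ ({emb o 0, emb o 1} : Set V) ∨ ∃ i : Fin k, (i : ℕ) < n ∧ ∃ x, emb i x = v}
  let E : ℕ → V → V → Prop := fun n u v =>
    (u = emb o 0 ∧ v = emb o 1) ∨
      ∃ i : Fin k, (i : ℕ) < n ∧ ∃ x, emb i x = u ∧ emb i (x + 1) = v
  have hEU : ∀ n u v, E n u v → u ∈ U n ∧ v ∈ U n := by
    rintro n u v (⟨rfl, rfl⟩ | ⟨i, hi, x, rfl, rfl⟩)
    · exact ⟨.inl (by simp), .inl (by simp)⟩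
    · exact ⟨.inr ⟨i, hi, _, rfl⟩, .inr ⟨i, hi, _, rfl⟩⟩
  have hglue : ∀ n (hn : n < k), ∃ y, (∀ z, emb ⟨n, hn⟩ z ∈ U n ↔ z = y ∨ z = y + 1) ∧
      (E n (emb ⟨n, hn⟩ y) (emb ⟨n, hn⟩ (y + 1)) ∨
        E n (emb ⟨n, hn⟩ (y + 1)) (emb ⟨n, hn⟩ y)) := by
    intro n hn
    rcases n with _ | m
    · refine ⟨0, fun z => ?_, .inl (.inl ⟨rfl, by rw [zero_add]⟩)⟩
      have hi : Function.Injective (emb o) := hinj o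
      change (emb o z ∈ ({emb o 0, emb o 1} : Set V) ∨ _) ↔ _
      simp [hi.eq_iff]
    · have hm : m < k := by omega
      obtain ⟨x, y, hint, hor⟩ := hconsec ⟨m, hm⟩ hn
      refine ⟨y, fun z => ?_, ?_⟩
      · have hmem : emb ⟨m + 1, hn⟩ z ∈ U (m + 1) ↔
            emb ⟨m + 1, hn⟩ z ∈ Set.range (emb ⟨m, hm⟩) := by
          have hold : ∀ i : Fin k, (i : ℕ) < m + 1 → ∀ t, emb i t = emb ⟨m + 1, hn⟩ z →
              emb ⟨m + 1, hn⟩ z ∈ Set.range (emb ⟨m, hm⟩) := by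
            intro i hi t ht
            by_cases him : i = ⟨m, hm⟩
            · exact him ▸ ⟨t, ht⟩
            · have := hfar i ⟨m + 1, hn⟩ (by
                have := Fin.val_ne_of_ne him
                simp only at this ⊢
                omega)
              exact absurd (show emb i t ∈ (∅ : Set V) from
                this ▸ ⟨⟨t, rfl⟩, ⟨z, ht.symm⟩⟩) (Set.notMem_empty _)
          constructor
          · rintro ((h | h) | ⟨i, hi, t, ht⟩)
            · exact hold o (Nat.succ_pos m) _ h.symm
            · exact hold o (Nat.succ_pos m) _ h.symm
            · exact hold i hi t ht
          · rintro ⟨t, ht⟩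
            exact .inr ⟨⟨m, hm⟩, Nat.lt_succ_self m, t, ht⟩
        have hmem' : emb ⟨m + 1, hn⟩ z ∈ Set.range (emb ⟨m, hm⟩) ↔
            emb ⟨m + 1, hn⟩ z ∈
              ({emb ⟨m, hm⟩ x, emb ⟨m, hm⟩ (x + 1)} : Set V) := by
          rw [← hint]; exact ⟨fun h => ⟨h, z, rfl⟩, fun h => h.1⟩
        rw [hmem, hmem']
        rcases hor with ⟨h1, h2⟩ | ⟨h1, h2⟩ <;>
          simp [← h1, ← h2, (hinj ⟨m + 1, hn⟩).eq_iff, or_comm]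
      · rcases hor with ⟨h1, h2⟩ | ⟨h1, h2⟩ <;> rw [h1, h2]
        · exact .inl (.inr ⟨⟨m, hm⟩, Nat.lt_succ_self m, x, rfl, rfl⟩)
        · exact .inr (.inr ⟨⟨m, hm⟩, Nat.lt_succ_self m, x, rfl, rfl⟩)
  have hstep : ∀ n (hn : n < k),
      2 * Nat.card (unitStepLabelings (U (n + 1)) (E (n + 1)) (emb o 0)) =
        Nat.card (unitStepLabelings (U n) (E n) (emb o 0)) *
          Nat.choose (2 * a ⟨n, hn⟩) (a ⟨n, hn⟩) := by
    intro n hn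
    obtain ⟨y, hy, hE⟩ := hglue n hn
    have hshift : ∀ z, emb ⟨n, hn⟩ z = emb ⟨n, hn⟩ (z - y + y) := fun z => by
      rw [sub_add_cancel]
    have hU' : U (n + 1) = U n ∪ Set.range fun z => emb ⟨n, hn⟩ (z + y) := by
      ext v
      constructor
      · rintro (h | ⟨i, hi, x, rfl⟩)
        · exact .inl (.inl h)
        · by_cases hin : (i : ℕ) = n
          · obtain rfl : i = ⟨n, hn⟩ := Fin.ext hin
            exact .inr ⟨x - y, (hshift x).symm⟩
          · exact .inl (.inr ⟨i, by omega, x, rfl⟩)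
      · rintro ((h | ⟨i, hi, x, rfl⟩) | ⟨z, rfl⟩)
        · exact .inl h
        · exact .inr ⟨i, by omega, x, rfl⟩
        · exact .inr ⟨⟨n, hn⟩, Nat.lt_succ_self n, _, rfl⟩
    have hE' : E (n + 1) = fun u v => E n u v ∨
        ∃ z, emb ⟨n, hn⟩ (z + y) = u ∧ emb ⟨n, hn⟩ (z + 1 + y) = v := by
      funext u v
      apply propext
      constructor
      · rintro (h | ⟨i, hi, x, rfl, rfl⟩)
        · exact .inl (.inl h)
        · by_cases hin : (i : ℕ) = n
          · obtain rfl : i = ⟨n, hn⟩ := Fin.ext hin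
            exact .inr ⟨x - y, (hshift x).symm, by congr 1; ring⟩
          · exact .inl (.inr ⟨i, by omega, x, rfl, rfl⟩)
      · rintro ((h | ⟨i, hi, x, rfl, rfl⟩) | ⟨z, rfl, rfl⟩)
        · exact .inl h
        · exact .inr ⟨i, by omega, x, rfl, rfl⟩
        · exact .inr ⟨⟨n, hn⟩, Nat.lt_succ_self n, z + y, rfl, by congr 1; ring⟩
    rw [hU', hE', card_unitStepLabelings_glue (.inl (.inl rfl)) (hEU n)
      (fun z => emb ⟨n, hn⟩ (z + y)) ((hinj _).comp (add_left_injective y))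
      (fun z => by rw [hy]; simp [add_comm y]) (by simpa [add_comm y] using hE),
      ← two_mul_card_closedUnitWalks (by have := ha ⟨n, hn⟩; omega)]
    ring
  have hedge : Nat.card (unitStepLabelings (U 0) (E 0) (emb o 0)) = 2 := by
    have hU0 : U 0 = {emb o 0, emb o 1} := by ext v; simp [U]
    have hE0 : E 0 = fun u v => u = emb o 0 ∧ v = emb o 1 := by funext u v; simp [E]
    rw [hU0, hE0]
    exact card_unitStepLabelings_edge fun h => zero_ne_one (hinj o h)
  have hcount : ∀ n (hn : n ≤ k),
      2 ^ n * Nat.card (unitStepLabelings (U n) (E n) (emb o 0)) =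
        2 * ∏ i : Fin n, Nat.choose (2 * a (i.castLE hn)) (a (i.castLE hn)) := by
    intro n hn
    induction n with
    | zero => simp [hedge]
    | succ n ih =>
      rw [pow_succ, mul_assoc, hstep n hn, ← mul_assoc, ih (by omega), Fin.prod_univ_castSucc,
        mul_assoc]
      rfl
  have hfull : 2 ^ (k - 1) * Nat.card (unitStepLabelings (U k) (E k) (emb o 0)) =
      ∏ i : Fin k, Nat.choose (2 * a i) (a i) := by
    have h := hcount k le_rfl
    obtain ⟨m, rfl⟩ : ∃ m, k = m + 1 := ⟨k - 1, by omega⟩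
    rw [pow_succ', mul_assoc] at h
    exact Nat.eq_of_mul_eq_mul_left two_pos h
  have hEadj : ∀ f : V → ℤ, (∀ u v, E k u v → |f v - f u| = 1) ↔
      ∀ u v, H.Adj u v → |f u - f v| = 1 := by
    intro f
    constructor
    · intro h u v huv
      obtain ⟨i, x, hx | hx⟩ := (hadj u v).mp huv
      · rw [abs_sub_comm]; exact h u v (.inr ⟨i, i.2, x, hx⟩)
      · exact h v u (.inr ⟨i, i.2, x, hx⟩)
    · rintro h u v (⟨rfl, rfl⟩ | ⟨i, -, x, rfl, rfl⟩)
      · rw [abs_sub_comm]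
        refine h _ _ ?_
        simpa using hcyc o 0
      · rw [abs_sub_comm]; exact h _ _ (hcyc i x)
  have hlab : ∀ f, f ∈ unitStepLabelings (U k) (E k) (emb o 0) ↔
      f (emb o 0) = 0 ∧ ∀ u v, H.Adj u v → |f u - f v| = 1 := by
    intro f
    rw [← hEadj]
    refine ⟨fun h => h.2, fun h => ⟨fun v hv => absurd ?_ hv, h⟩⟩
    obtain ⟨i, x, hx⟩ := hcover v
    exact .inr ⟨i, i.2, x, hx⟩
  have hconn : H.Connected := by
    have hreach : ∀ n (hn : n < k), ∀ x, H.Reachable (emb o 0) (emb ⟨n, hn⟩ x) := by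
      intro n
      induction n with
      | zero => exact fun _ x => reachable_of_adj_add_one (hcyc o) 0 x
      | succ n ih =>
        intro hn x
        obtain ⟨t, y, -, h⟩ := hconsec ⟨n, by omega⟩ hn
        refine Reachable.trans ?_ (reachable_of_adj_add_one (hcyc ⟨n + 1, hn⟩) y x)
        rcases h with ⟨h, -⟩ | ⟨h, -⟩ <;> rw [h] <;> exact ih _ _
    have hreach' : ∀ v, H.Reachable (emb o 0) v := fun v => by
      obtain ⟨i, x, rfl⟩ := hcover v
      exact hreach i i.2 x
    exact { preconnected := fun u v => (hreach' u).symm.trans (hreach' v), nonempty := ⟨v0⟩ }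
  have hpos : 0 < Nat.card (unitStepLabelings (U k) (E k) (emb o 0)) := by
    refine Nat.pos_of_ne_zero fun h => ?_
    rw [h, mul_zero] at hfull
    exact (Finset.prod_pos fun i _ => Nat.choose_pos (by omega)).ne hfull
  obtain ⟨⟨g, hg⟩⟩ := (Nat.card_pos_iff.mp hpos).1
  have hfacet := isFacetLabeling_iff_of_unitStep hconn ((hlab g).mp hg).2 v0
  rw [← hfull]
  congr 1
  exact Nat.card_congr
    { toFun := fun f => ⟨fun v => f.1 v - f.1 (emb o 0),
        (hlab _).mpr ⟨sub_self _, fun u v huv => by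
          rw [sub_sub_sub_cancel_right]; exact ((hfacet _).mp f.2).2 u v huv⟩⟩
      invFun := fun f => ⟨fun v => f.1 v - f.1 v0,
        (hfacet _).mpr ⟨sub_self _, fun u v huv => by
          rw [sub_sub_sub_cancel_right]; exact ((hlab _).mp f.2).2 u v huv⟩⟩
      left_inv := fun f => Subtype.ext <| funext fun v => by
        simp [((hfacet _).mp f.2).1]
      right_inv := fun f => Subtype.ext <| funext fun v => by
        simp [((hlab _).mp f.2).1] }
end

section
/- Let n ≥ 3 and let W = K1 * C_n be the wheel graph with cone vertex c and outer vertices ℤ/nℤ. A function f : V(W) → ℤ with f(c) = 0 is a facet-defining labeling of W based at c if and only if f(i) ∈ {−1, 0, 1} for every outer vertex i, there is no i ∈ ℤ/nℤ with {f(i), f(i+1)} = {1, −1}, and there is no i ∈ ℤ/nℤ with f(i) = f(i+1) = f(i+2) = 0. Consequently, the number of facets of the symmetric edge polytope P_W equals the number of functions w : ℤ/nℤ → {−1, 0, 1} satisfying these two avoidance conditions. -/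
open SimpleGraph

/-- The wheel graph `K1 * C_n`: vertices are `ℤ/nℤ` (outer cycle) plus a cone vertex
`none`; edges are the outer edges `{some i, some (i+1)}` and the spokes
`{none, some i}`. -/
def wheelGraph (n : ℕ) : SimpleGraph (Option (ZMod n)) :=
  SimpleGraph.fromRel (fun u v =>
    (u = none ∧ v ≠ none) ∨ ∃ i : ZMod n, u = some i ∧ v = some (i + 1))

theorem wheelGraph_adj_none_some {n : ℕ} (i : ZMod n) : (wheelGraph n).Adj none (some i) := by
  simp [wheelGraph]

theorem wheelGraph_adj_some_some {n : ℕ} {i j : ZMod n} :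
    (wheelGraph n).Adj (some i) (some j) ↔ i ≠ j ∧ (j = i + 1 ∨ i = j + 1) := by
  simp [wheelGraph]

theorem wheelGraph_adj_some_add_one {n : ℕ} (hn : 1 < n) (i : ZMod n) :
    (wheelGraph n).Adj (some i) (some (i + 1)) := by
  have : Fact (1 < n) := ⟨hn⟩
  simp [wheelGraph_adj_some_some]

/-- An edge-Lipschitz labeling of the wheel that vanishes at the cone vertex amounts to a cyclic
word over `{-1, 0, 1}` in which `1` and `-1` are never adjacent. -/
theorem wheelGraph_lipschitz_iff {n : ℕ} (hn : 1 < n) {f : Option (ZMod n) → ℤ}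
    (h0 : f none = 0) :
    (∀ u v, (wheelGraph n).Adj u v → |f u - f v| ≤ 1) ↔
      (∀ i : ZMod n, f (some i) = -1 ∨ f (some i) = 0 ∨ f (some i) = 1) ∧
      ∀ i : ZMod n, ¬((f (some i) = 1 ∧ f (some (i + 1)) = -1) ∨
        (f (some i) = -1 ∧ f (some (i + 1)) = 1)) := by
  constructor
  · intro h
    refine ⟨fun i => ?_, fun i => ?_⟩
    · have hi := abs_le.mp (h _ _ (wheelGraph_adj_none_some i))
      omega
    · have hi := abs_le.mp (h _ _ (wheelGraph_adj_some_add_one hn i))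
      omega
  · rintro ⟨hval, hsign⟩ (_ | i) (_ | j) huv
    · exact absurd huv ((wheelGraph n).irrefl)
    · have hj := hval j
      rw [abs_le]
      omega
    · have hi := hval i
      rw [abs_le]
      omega
    · have hi := hval i
      have hj := hval j
      rw [abs_le]
      obtain ⟨-, rfl | rfl⟩ := wheelGraph_adj_some_some.mp huv
      · have hs := hsign i
        omega
      · have hs := hsign j
        omega

/-- For a word over `{-1, 0, 1}`, the edges along which the labeling changes by one connect the
wheel exactly when the word has no three cyclically consecutive zeros. -/
theorem labelSubgraph_wheelGraph_connected_iff {n : ℕ} (hn : 1 < n) {f : Option (ZMod n) → ℤ}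
    (h0 : f none = 0) (hval : ∀ i : ZMod n, f (some i) = -1 ∨ f (some i) = 0 ∨ f (some i) = 1) :
    (labelSubgraph (wheelGraph n) f).Connected ↔
      ∀ i : ZMod n, ¬(f (some i) = 0 ∧ f (some (i + 1)) = 0 ∧ f (some (i + 2)) = 0) := by
  constructor
  · rintro hconn i ⟨hi, hi1, hi2⟩
    obtain ⟨_ | j, hadj, habs⟩ := hconn.preconnected.exists_adj_of_nontrivial (some (i + 1))
    · simp [h0, hi1] at habs
    · obtain ⟨-, rfl | hj⟩ := wheelGraph_adj_some_some.mp hadj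
      · rw [add_assoc, one_add_one_eq_two, hi1, hi2] at habs
        simp at habs
      · rw [← add_right_cancel hj, hi1, hi] at habs
        simp at habs
  · intro hzero
    have hspoke (i : ZMod n) (hi : f (some i) ≠ 0) :
        (labelSubgraph (wheelGraph n) f).Reachable none (some i) := by
      refine Adj.reachable ⟨wheelGraph_adj_none_some i, ?_⟩
      rcases hval i with h | h | h <;> simp_all
    have hrim (i : ZMod n) (h : f (some i) = 0 ↔ f (some (i + 1)) ≠ 0) :
        (labelSubgraph (wheelGraph n) f).Reachable (some i) (some (i + 1)) := by
      refine Adj.reachable ⟨wheelGraph_adj_some_add_one hn i, ?_⟩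
      rcases hval i with h | h | h <;> rcases hval (i + 1) with h' | h' | h' <;> simp_all
    refine connected_iff_exists_forall_reachable _ |>.mpr ⟨none, ?_⟩
    rintro (_ | j)
    · exact Reachable.refl _
    obtain ⟨i, rfl⟩ : ∃ i, i + 1 = j := ⟨j - 1, sub_add_cancel j 1⟩
    by_cases hi1 : f (some (i + 1)) = 0
    · by_cases hi : f (some i) = 0
      · have hi2 : f (some (i + 1 + 1)) ≠ 0 := by
          rw [add_assoc, one_add_one_eq_two]
          exact fun hi2 => hzero i ⟨hi, hi1, hi2⟩
        exact (hspoke _ hi2).trans (hrim (i + 1) (by simp [hi1, hi2])).symm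
      · exact (hspoke i hi).trans (hrim i (by simp [hi, hi1]))
    · exact hspoke _ hi1

theorem isFacetLabeling_wheelGraph_iff {n : ℕ} (hn : 1 < n) {f : Option (ZMod n) → ℤ}
    (h0 : f none = 0) :
    IsFacetLabeling (wheelGraph n) none f ↔
      (∀ i : ZMod n, f (some i) = -1 ∨ f (some i) = 0 ∨ f (some i) = 1) ∧
      (∀ i : ZMod n, ¬((f (some i) = 1 ∧ f (some (i + 1)) = -1) ∨
        (f (some i) = -1 ∧ f (some (i + 1)) = 1))) ∧
      ∀ i : ZMod n, ¬(f (some i) = 0 ∧ f (some (i + 1)) = 0 ∧ f (some (i + 2)) = 0) := by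
  rw [IsFacetLabeling, wheelGraph_lipschitz_iff hn h0, and_assoc]
  constructor
  · rintro ⟨-, hval, hsign, hconn⟩
    exact ⟨hval, hsign, (labelSubgraph_wheelGraph_connected_iff hn h0 hval).mp hconn⟩
  · rintro ⟨hval, hsign, hzero⟩
    exact ⟨h0, hval, hsign, (labelSubgraph_wheelGraph_connected_iff hn h0 hval).mpr hzero⟩

/-- For `n ≥ 3` and the wheel graph `W = K1 * C_n` with cone vertex
`none`, a function `f` with `f(cone) = 0` is a facet-defining labeling based at the
cone vertex iff all outer values lie in `{-1, 0, 1}`, no two cyclically consecutive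
outer values are `{1, -1}`, and no three cyclically consecutive outer values are all
`0`. Consequently, the number of facets of `P_W` equals the number of such cyclic
words `w : ℤ/nℤ → {-1, 0, 1}`. -/
theorem stmt12 (n : ℕ) (hn : 3 ≤ n) :
    (∀ f : Option (ZMod n) → ℤ, f none = 0 →
      (IsFacetLabeling (wheelGraph n) none f ↔
        ((∀ i : ZMod n, f (some i) = -1 ∨ f (some i) = 0 ∨ f (some i) = 1) ∧
         (∀ i : ZMod n, ¬((f (some i) = 1 ∧ f (some (i + 1)) = -1) ∨
            (f (some i) = -1 ∧ f (some (i + 1)) = 1))) ∧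
         (∀ i : ZMod n, ¬(f (some i) = 0 ∧ f (some (i + 1)) = 0 ∧
            f (some (i + 2)) = 0))))) ∧
    Nat.card {f : Option (ZMod n) → ℤ // IsFacetLabeling (wheelGraph n) none f} =
      Nat.card {w : ZMod n → ℤ //
        (∀ i, w i = -1 ∨ w i = 0 ∨ w i = 1) ∧
        (∀ i, ¬((w i = 1 ∧ w (i + 1) = -1) ∨ (w i = -1 ∧ w (i + 1) = 1))) ∧
        (∀ i, ¬(w i = 0 ∧ w (i + 1) = 0 ∧ w (i + 2) = 0))} := by
  have hn1 : 1 < n := by omega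
  refine ⟨fun f h0 => isFacetLabeling_wheelGraph_iff hn1 h0, Nat.card_congr ?_⟩
  exact
    { toFun := fun f => ⟨fun i => f.1 (some i), (isFacetLabeling_wheelGraph_iff hn1 f.2.1).mp f.2⟩
      invFun := fun w => ⟨fun v => v.elim 0 w.1,
        (isFacetLabeling_wheelGraph_iff hn1 rfl).mpr w.2⟩
      left_inv := by
        rintro ⟨f, hf⟩
        ext (_ | i)
        · exact hf.1.symm
        · rfl
      right_inv := fun _ => rfl }
end
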